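/- Let f : (k+1)^V → ℝ be a nonnegative monotone k-submodular function with f(0) = 0, let c be a cost function on V, let B > 0 be a budget, and let o* ∈ (k+1)^V with c(o*) ≤ B and supp(o*) ≠ ∅. Let y ⪯ o* with |supp(y)| = 1 and f(y) ≥ f(y') for every y' ⪯ o* with |supp(y')| = 1, and let y = s^{(0)} ⪯ s^{(1)} ⪯ … ⪯ s^{(m)} = s be a greedy sequence relative to o*. If there exists e ∈ supp(o*)∖supp(s) with c(s) + c(e) > B, then 2·f(s) ≥ f(o*). -/

import Mathlib

open Finset

section KSubmodularDefs

variable {V : Type*} [Fintype V] [DecidableEq V] {k : ℕ}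

/-- The support of a `k`-tuple `x : V → Fin (k+1)` (value `0` means "not selected"). -/
def ksupp (x : V → Fin (k+1)) : Finset V := Finset.univ.filter fun e => x e ≠ 0

/-- The meet `x ⊓ y`. -/
def kinf (x y : V → Fin (k+1)) : V → Fin (k+1) :=
  fun e => if x e = y e then x e else 0

/-- The join `x ⊔ y`. -/
def ksup (x y : V → Fin (k+1)) : V → Fin (k+1) :=
  fun e => if y e = 0 ∨ y e = x e then x e else if x e = 0 then y e else 0

/-- `f` is `k`-submodular. -/
def KSubmodular (f : (V → Fin (k+1)) → ℝ) : Prop :=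
  ∀ x y : V → Fin (k+1), f (ksup x y) + f (kinf x y) ≤ f x + f y

/-- The partial order `x ⪯ y` on `(k+1)^V`. -/
def kle (x y : V → Fin (k+1)) : Prop := ∀ e : V, x e = 0 ∨ x e = y e

/-- `f` is monotone with respect to `⪯`. -/
def KMonotone (f : (V → Fin (k+1)) → ℝ) : Prop :=
  ∀ x y : V → Fin (k+1), kle x y → f x ≤ f y

/-- The marginal gain `Δ_{e,j}(x)` of assigning element `e` to component `j`. -/
def margin (f : (V → Fin (k+1)) → ℝ) (x : V → Fin (k+1)) (e : V) (j : Fin (k+1)) : ℝ :=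
  f (Function.update x e j) - f x

/-- The total cost `c(x)` of a tuple. -/
def kcost (c : V → ℝ) (x : V → Fin (k+1)) : ℝ := ∑ e ∈ ksupp x, c e

/-- One step of a greedy sequence relative to `o`: pick `e ∉ supp x` and `j ∈ {1,…,k}`
maximizing the marginal gain over components (a), and with marginal density at least that of
every pair `(e', j')` with `e' ∈ supp o \ supp x` (b). -/
def GreedyStep (f : (V → Fin (k+1)) → ℝ) (c : V → ℝ) (o : V → Fin (k+1))
    (x x' : V → Fin (k+1)) : Prop :=
  ∃ e : V, ∃ j : Fin (k+1), x e = 0 ∧ j ≠ 0 ∧ x' = Function.update x e j ∧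
    (∀ j' : Fin (k+1), j' ≠ 0 → margin f x e j' ≤ margin f x e j) ∧
    (∀ e' : V, o e' ≠ 0 → x e' = 0 → ∀ j' : Fin (k+1), j' ≠ 0 →
      margin f x e' j' * c e ≤ margin f x e j * c e')

/-- `GreedyRun f c B s V0 out`: starting from partial solution `s` with remaining elements `V0`,
the greedy procedure with budget `B` (under some tie-breaking) can terminate with output `out`.
At each step a pair `(e, j)` of maximum marginal density among remaining elements is chosen;
`e` is added (placed in component `j`) iff it fits in the remaining budget, and is removed
from the remaining pool in either case. -/
inductive GreedyRun (f : (V → Fin (k+1)) → ℝ) (c : V → ℝ) (B : ℝ) :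
    (V → Fin (k+1)) → Finset V → (V → Fin (k+1)) → Prop where
  | done (s : V → Fin (k+1)) : GreedyRun f c B s ∅ s
  | take (s : V → Fin (k+1)) (V0 : Finset V) (e : V) (j : Fin (k+1))
      (out : V → Fin (k+1)) (he : e ∈ V0) (hj : j ≠ 0)
      (hbest : ∀ e' ∈ V0, ∀ j' : Fin (k+1), j' ≠ 0 →
        margin f s e' j' / c e' ≤ margin f s e j / c e)
      (hfit : kcost c s + c e ≤ B)
      (hrest : GreedyRun f c B (Function.update s e j) (V0.erase e) out) :
      GreedyRun f c B s V0 out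
  | skip (s : V → Fin (k+1)) (V0 : Finset V) (e : V) (j : Fin (k+1))
      (out : V → Fin (k+1)) (he : e ∈ V0) (hj : j ≠ 0)
      (hbest : ∀ e' ∈ V0, ∀ j' : Fin (k+1), j' ≠ 0 →
        margin f s e' j' / c e' ≤ margin f s e j / c e)
      (hnofit : ¬ kcost c s + c e ≤ B)
      (hrest : GreedyRun f c B s (V0.erase e) out) :
      GreedyRun f c B s V0 out

/-- The `k`-multilinear extension of `f`, as a function of `x : V → Fin (k+1) → ℝ`
(only the coordinates `x e j` with `j ≠ 0` are relevant). -/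
noncomputable def kext (f : (V → Fin (k+1)) → ℝ) (x : V → Fin (k+1) → ℝ) : ℝ :=
  ∑ s : V → Fin (k+1), f s *
    ∏ e : V,
      (if s e = 0 then 1 - ∑ j ∈ Finset.univ.erase (0 : Fin (k+1)), x e j else x e (s e))

/-- The partial derivative of `F` with respect to the coordinate `(e, j)` at the point `x`. -/
noncomputable def pderiv (F : (V → Fin (k+1) → ℝ) → ℝ) (e : V) (j : Fin (k+1))
    (x : V → Fin (k+1) → ℝ) : ℝ :=
  deriv (fun t : ℝ => F (Function.update x e (Function.update (x e) j t))) (x e j)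

/-- Membership in the domain `Δ_k^V` of the multilinear extension. -/
def inSimplex (x : V → Fin (k+1) → ℝ) : Prop :=
  (∀ e : V, ∀ j : Fin (k+1), j ≠ 0 → 0 ≤ x e j ∧ x e j ≤ 1) ∧
  (∀ e : V, ∑ j ∈ Finset.univ.erase (0 : Fin (k+1)), x e j ≤ 1)

end KSubmodularDefs

section KSubmodularLemmas

variable {V : Type*} {k : ℕ}

theorem mem_ksupp [Fintype V] {x : V → Fin (k+1)} {e : V} : e ∈ ksupp x ↔ x e ≠ 0 := by
  simp [ksupp]

/-- Overwrite `o` by the nonzero values of `x`. -/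
def overwrite (x o : V → Fin (k+1)) : V → Fin (k+1) := fun e => if x e = 0 then o e else x e

theorem kle_trans {x y z : V → Fin (k+1)} (hxy : kle x y) (hyz : kle y z) : kle x z := by
  intro e
  have h1 := hxy e
  have h2 := hyz e
  grind

variable [DecidableEq V]

theorem kle_update {x : V → Fin (k+1)} {e : V} (he : x e = 0) (j : Fin (k+1)) :
    kle x (Function.update x e j) := by
  intro a
  by_cases h : a = e
  · subst h; exact Or.inl he
  · right; simp [h]

/-- Diminishing returns along the order `⪯`. -/
theorem KSubmodular.margin_anti {f : (V → Fin (k+1)) → ℝ} (hf : KSubmodular f)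
    {x z : V → Fin (k+1)} (hxz : kle x z) {e : V} (hz : z e = 0) (j : Fin (k+1)) :
    margin f z e j ≤ margin f x e j := by
  have hx : x e = 0 := by
    have := hxz e
    grind
  have hsup : ksup (Function.update x e j) z = Function.update z e j := by
    funext a
    have := hxz a
    by_cases h : a = e
    · subst h; simp [ksup, hz]
    · simp only [ksup, Function.update_of_ne h]
      grind
  have hinf : kinf (Function.update x e j) z = x := by
    funext a
    have := hxz a
    by_cases h : a = e
    · subst h; simp only [kinf, Function.update_self]; grind
    · simp only [kinf, Function.update_of_ne h]
      grind
  have h := hf (Function.update x e j) z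
  rw [hsup, hinf] at h
  unfold margin
  linarith

/-- Adding the values of `o` on `T` gains at most the sum of the individual marginal gains. -/
theorem KSubmodular.le_add_sum_margin {f : (V → Fin (k+1)) → ℝ} (hf : KSubmodular f)
    (x o : V → Fin (k+1)) (T : Finset V) (hT : ∀ e ∈ T, x e = 0) :
    f (fun e => if e ∈ T then o e else x e) ≤ f x + ∑ e ∈ T, margin f x e (o e) := by
  induction T using Finset.induction_on with
  | empty => simp
  | insert a T ha ih =>
    have ih := ih fun e he => hT e (Finset.mem_insert_of_mem he)
    have hxa := hT a (Finset.mem_insert_self a T)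
    set z : V → Fin (k+1) := fun e => if e ∈ T then o e else x e with hz
    have hxz : kle x z := by
      intro e
      by_cases h : e ∈ T
      · exact Or.inl (hT e (Finset.mem_insert_of_mem h))
      · right; simp [hz, h]
    have hupd : (fun e => if e ∈ insert a T then o e else x e) = Function.update z a (o a) := by
      funext e
      by_cases h : e = a
      · subst h; simp
      · simp [hz, h]
    have hmar := hf.margin_anti hxz (e := a) (by simp [hz, ha, hxa]) (o a)
    rw [hupd, Finset.sum_insert ha]
    unfold margin at hmar ih ⊢
    linarith

/-- Overwriting `o` by one more coordinate loses at most the marginal gain of `o`'s value. -/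
theorem KSubmodular.overwrite_le_add_margin {f : (V → Fin (k+1)) → ℝ} (hf : KSubmodular f)
    (hmono : KMonotone f) {x o : V → Fin (k+1)} {e : V} (he : x e = 0) {j : Fin (k+1)} :
    f (overwrite x o) ≤ f (overwrite (Function.update x e j) o) + margin f x e (o e) := by
  set z := Function.update (overwrite x o) e 0 with hz
  have hxz : kle x z := by
    intro a
    by_cases h : a = e
    · subst h; exact Or.inl he
    · simp only [hz, Function.update_of_ne h, overwrite]
      grind
  have hupd : Function.update z e (o e) = overwrite x o := by
    funext a
    by_cases h : a = e
    · subst h; simp [overwrite, he]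
    · simp [hz, h]
  have hle : kle z (overwrite (Function.update x e j) o) := by
    intro a
    by_cases h : a = e
    · subst h; left; simp [hz]
    · right; simp [hz, h, overwrite]
  have h1 := hf.margin_anti hxz (e := e) (by simp [hz]) (o e)
  have h2 := hmono _ _ hle
  have h3 : margin f z e (o e) = f (overwrite x o) - f z := by rw [margin, hupd]
  linarith

theorem kle_overwrite_update {x o : V → Fin (k+1)} {e : V} (he : x e = 0) (ho : o e = 0)
    (j : Fin (k+1)) : kle (overwrite x o) (overwrite (Function.update x e j) o) := by
  intro a
  by_cases h : a = e
  · subst h; left; simp [overwrite, he, ho]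
  · right; simp [overwrite, h]

theorem ksupp_update [Fintype V] {x : V → Fin (k+1)} {e : V} {j : Fin (k+1)} (hj : j ≠ 0) :
    ksupp (Function.update x e j) = insert e (ksupp x) := by
  ext a
  by_cases h : a = e
  · subst h; simp [mem_ksupp, hj]
  · simp [mem_ksupp, h]

/-- A greedy step pays for the loss of overwriting `o`, and, outside `supp o`, for any density
`r` attained by an element of `supp o` that is still available. -/
theorem GreedyStep.potential_le [Fintype V] {f : (V → Fin (k+1)) → ℝ} (hf : KSubmodular f)
    (hmono : KMonotone f) {c : V → ℝ} (hc : ∀ e, 0 < c e) {o x x' : V → Fin (k+1)}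
    (hstep : GreedyStep f c o x x') {e₀ : V} {r : ℝ} (ho : o e₀ ≠ 0) (hx : x e₀ = 0)
    (hr : r * c e₀ ≤ margin f x e₀ (o e₀)) :
    f (overwrite x o) - f x + r * ∑ e ∈ ksupp x' \ ksupp o, c e ≤
      f (overwrite x' o) - f x + (f x' - f x) + r * ∑ e ∈ ksupp x \ ksupp o, c e := by
  obtain ⟨e, j, he, hj, rfl, hbest, hdens⟩ := hstep
  rw [ksupp_update hj]
  by_cases hoe : o e = 0
  · have hmem : e ∉ ksupp o := by simp [mem_ksupp, hoe]
    have hnot : e ∉ ksupp x \ ksupp o := by simp [mem_ksupp, he]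
    rw [Finset.insert_sdiff_of_notMem _ hmem, Finset.sum_insert hnot]
    have h1 := hmono _ _ (kle_overwrite_update he hoe j)
    have h2 : r * c e ≤ margin f x e j := by
      have h3 := hdens e₀ ho hx (o e₀) ho
      have h4 := mul_le_mul_of_nonneg_right hr (hc e).le
      refine le_of_mul_le_mul_right ?_ (hc e₀)
      linarith
    unfold margin at h2
    linarith
  · rw [Finset.insert_sdiff_of_mem _ (mem_ksupp.2 hoe)]
    have h1 := hf.overwrite_le_add_margin hmono (o := o) he (j := j)
    have h2 := hbest (o e) hoe
    unfold margin at h1 h2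
    linarith

end KSubmodularLemmas

/-- Monotone case: if the greedy sequence relative to an optimal-type solution
`o*` starts from the best singleton `y ⪯ o*`, and at its end some element of
`supp(o*) \ supp(s)` no longer fits in the budget, then `2·f(s) ≥ f(o*)`. -/
theorem one_guess_greedy_rejection_monotone
    {V : Type*} [Fintype V] [DecidableEq V] {k : ℕ} (hk : 1 ≤ k)
    (f : (V → Fin (k+1)) → ℝ)
    (hsub : KSubmodular f) (hmono : KMonotone f)
    (hnonneg : ∀ x : V → Fin (k+1), 0 ≤ f x) (hzero : f (fun _ => 0) = 0)
    (c : V → ℝ) (hc : ∀ e : V, 0 < c e) (B : ℝ) (hB : 0 < B)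
    (ostar : V → Fin (k+1)) (hoB : kcost c ostar ≤ B) (hone : (ksupp ostar).Nonempty)
    (y : V → Fin (k+1)) (hyle : kle y ostar) (hycard : (ksupp y).card = 1)
    (hybest : ∀ y' : V → Fin (k+1), kle y' ostar → (ksupp y').card = 1 → f y' ≤ f y)
    (m : ℕ) (s : ℕ → V → Fin (k+1))
    (h0 : s 0 = y)
    (hstep : ∀ i < m, GreedyStep f c ostar (s i) (s (i+1)))
    (hrej : ∃ e ∈ ksupp ostar \ ksupp (s m), B < kcost c (s m) + c e) :
    f ostar ≤ 2 * f (s m) := by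
  obtain ⟨e', he', hlt⟩ := hrej
  set R := ksupp ostar \ ksupp (s m) with hR
  have hRo : ∀ e ∈ R, ostar e ≠ 0 := fun e he => mem_ksupp.1 (Finset.mem_sdiff.1 he).1
  have hRs : ∀ e ∈ R, s m e = 0 := fun e he => by
    simpa [mem_ksupp] using (Finset.mem_sdiff.1 he).2
  have hchain : ∀ i ≤ m, kle (s i) (s m) := by
    intro i hi
    induction hi using Nat.decreasingInduction with
    | self => exact fun e => Or.inr rfl
    | of_succ i hi ih =>
      obtain ⟨e, j, he, -, hs, -⟩ := hstep i hi
      exact kle_trans (hs ▸ kle_update he j) ih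
  obtain ⟨e₀, he₀, hmax⟩ :=
    Finset.exists_max_image R (fun e => margin f (s m) e (ostar e) / c e) ⟨e', he'⟩
  set r := margin f (s m) e₀ (ostar e₀) / c e₀ with hr
  have hr0 : 0 ≤ r := by
    refine div_nonneg ?_ (hc e₀).le
    exact sub_nonneg.2 (hmono _ _ (kle_update (hRs e₀ he₀) _))
  have hdens : ∀ e ∈ R, margin f (s m) e (ostar e) ≤ r * c e := fun e he =>
    (div_le_iff₀ (hc e)).1 (hmax e he)
  have hpot : ∀ i ≤ m, f ostar + r * ∑ e ∈ ksupp (s i) \ ksupp ostar, c e ≤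
      f (overwrite (s i) ostar) + f (s i) - f y := by
    intro i
    induction i with
    | zero =>
      intro _
      have h1 : ksupp y \ ksupp ostar = ∅ := by
        rw [Finset.sdiff_eq_empty_iff_subset]
        intro e he
        rw [mem_ksupp] at he ⊢
        have := hyle e
        grind
      have h2 : overwrite y ostar = ostar := by
        funext e
        have := hyle e
        simp only [overwrite]
        grind
      simp [h0, h1, h2]
    | succ i ih =>
      intro hi
      have hle := hchain i (by omega)
      have hz : s i e₀ = 0 := by
        have := hle e₀
        rw [hRs e₀ he₀] at this
        simpa using this
      have hr' : r * c e₀ ≤ margin f (s i) e₀ (ostar e₀) := by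
        rw [hr, div_mul_cancel₀ _ (hc e₀).ne']
        exact hsub.margin_anti hle (hRs e₀ he₀) _
      have := (hstep i hi).potential_le hsub hmono hc (hRo e₀ he₀) hz hr'
      linarith [ih (by omega)]
  have hpotm := hpot m le_rfl
  have hfin : f (overwrite (s m) ostar) ≤ f (s m) + ∑ e ∈ R, margin f (s m) e (ostar e) := by
    convert hsub.le_add_sum_margin (s m) ostar R hRs using 2
    funext e
    simp only [overwrite, hR, Finset.mem_sdiff, mem_ksupp]
    grind
  have hsingle : margin f (s m) e' (ostar e') ≤ f y := by
    have h1 := hsub.margin_anti (x := fun _ => 0) (z := s m) (fun _ => Or.inl rfl)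
      (hRs e' he') (ostar e')
    have h2 := hybest (Function.update (fun _ => 0) e' (ostar e')) (by
      intro a
      by_cases h : a = e'
      · subst h; right; simp
      · left; simp [h]) (by
      rw [ksupp_update (hRo e' he')]
      simp [ksupp])
    unfold margin at h1 ⊢
    linarith
  have hrest : ∑ e ∈ R.erase e', margin f (s m) e (ostar e) ≤ r * ∑ e ∈ R.erase e', c e := by
    rw [Finset.mul_sum]
    exact Finset.sum_le_sum fun e he => hdens e (Finset.mem_of_mem_erase he)
  have hcost : ∑ e ∈ R.erase e', c e ≤ ∑ e ∈ ksupp (s m) \ ksupp ostar, c e := by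
    have h1 := Finset.sum_erase_add R c he'
    have h2 := Finset.sum_inter_add_sum_sdiff (ksupp ostar) (ksupp (s m)) c
    have h3 := Finset.sum_inter_add_sum_sdiff (ksupp (s m)) (ksupp ostar) c
    rw [Finset.inter_comm] at h3
    unfold kcost at hoB hlt
    linarith
  have hmul := mul_le_mul_of_nonneg_left hcost hr0
  have hsplit := Finset.sum_erase_add R (fun e => margin f (s m) e (ostar e)) he'
  linarith
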